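/- arXiv:math/9810153 — 3 statements merged into one kernel-verified Lean document; each statement's English description precedes it below -/
import Mathlib

section
/- Let g ≥ 1 and let ℍ_g = {τ ∈ M(g×g,ℂ) : τ = ᵀτ, Im τ positive definite} be the Siegel upper half space, and let 𝒟_g = {Z ∈ M(g×g,ℂ) : Z = ᵀZ, I_g − Z·conj(Z) positive definite (as a Hermitian matrix)}. Then for every τ ∈ ℍ_g the matrix τ + i·I_g is invertible, the Cayley transform Φ(τ) = (τ − i·I_g)(τ + i·I_g)^{−1} lies in 𝒟_g, and Φ : ℍ_g → 𝒟_g is a bijection. -/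
open Matrix
open scoped ComplexOrder

/-- The Siegel upper half space `ℍ_g` of symmetric complex `g×g` matrices with positive
definite imaginary part. -/
def SiegelHalfSpace (g : ℕ) : Set (Matrix (Fin g) (Fin g) ℂ) :=
  {τ | τᵀ = τ ∧ (Matrix.of fun i j => (τ i j).im).PosDef}

/-- The bounded symmetric domain `𝒟_g` of symmetric complex `g×g` matrices `Z` with
`I_g − Z·conj(Z)` positive definite (as a Hermitian matrix). -/
def SiegelDomain (g : ℕ) : Set (Matrix (Fin g) (Fin g) ℂ) :=
  {Z | Zᵀ = Z ∧ (1 - Z * Z.map (starRingEnd ℂ)).PosDef}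

namespace Matrix

variable {n : Type*}

theorem map_conj_eq_conjTranspose {Z : Matrix n n ℂ} (hZ : Zᵀ = Z) :
    Z.map (starRingEnd ℂ) = Zᴴ := by
  rw [conjTranspose, hZ]
  rfl

variable [Fintype n]

theorem posDef_map_ofReal_iff {S : Matrix n n ℝ} :
    (S.map ((↑) : ℝ → ℂ)).PosDef ↔ S.PosDef := by
  have herm : (S.map ((↑) : ℝ → ℂ)).IsHermitian ↔ S.IsHermitian := by
    simp [IsHermitian, ← Matrix.ext_iff]
  have re_quad (hS : S.IsHermitian) (x : n → ℂ) :
      star x ⬝ᵥ (S.map ((↑) : ℝ → ℂ)) *ᵥ x =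
        ((((fun i => (x i).re) ⬝ᵥ S *ᵥ fun i => (x i).re) +
          ((fun i => (x i).im) ⬝ᵥ S *ᵥ fun i => (x i).im) : ℝ) : ℂ) := by
    have him := (herm.2 hS).im_star_dotProduct_mulVec_self x
    apply Complex.ext
    · simp [dotProduct, mulVec, Finset.mul_sum, Finset.sum_add_distrib]
    · simpa using him
  constructor
  · intro h
    have hS := herm.1 h.1
    refine .of_dotProduct_mulVec_pos hS fun x hx => ?_
    have hx' : (fun i => (x i : ℂ)) ≠ 0 := fun h0 => hx <| funext fun i => by
      simpa using congrFun h0 i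
    have := h.dotProduct_mulVec_pos hx'
    rw [re_quad hS] at this
    have := Complex.zero_lt_real.1 this
    simpa [dotProduct, mulVec] using this
  · intro h
    refine .of_dotProduct_mulVec_pos (herm.2 h.1) fun x hx => ?_
    rw [re_quad h.1, Complex.zero_lt_real]
    have hnn (y : n → ℝ) : 0 ≤ y ⬝ᵥ S *ᵥ y := by
      simpa using h.posSemidef.dotProduct_mulVec_nonneg y
    have hpos (y : n → ℝ) (hy : y ≠ 0) : 0 < y ⬝ᵥ S *ᵥ y := by
      simpa using h.dotProduct_mulVec_pos hy
    by_cases hre : (fun i => (x i).re) = 0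
    · refine add_pos_of_nonneg_of_pos (hnn _) (hpos _ fun him => hx ?_)
      exact funext fun i => Complex.ext (congrFun hre i) (congrFun him i)
    · exact add_pos_of_pos_of_nonneg (hpos _ hre) (hnn _)

theorem isUnit_of_posDef_mul_add_conjTranspose [DecidableEq n] {A B : Matrix n n ℂ}
    (h : (A * B + Bᴴ * Aᴴ).PosDef) : IsUnit A := by
  rw [← isUnit_conjTranspose, ← mulVec_injective_iff_isUnit]
  refine (injective_iff_map_eq_zero Aᴴ.mulVecLin).2 fun v hv => ?_
  replace hv : Aᴴ *ᵥ v = 0 := hv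
  by_contra hne
  refine (h.dotProduct_mulVec_pos hne).ne' ?_
  have hv' : star v ᵥ* A = 0 := by
    simpa [star_mulVec] using congrArg star hv
  rw [add_mulVec, ← mulVec_mulVec, ← mulVec_mulVec, hv, dotProduct_add, dotProduct_mulVec, hv']
  simp

theorem posDef_smul_sub_conjTranspose_iff {τ : Matrix n n ℂ} (hτ : τᵀ = τ) :
    (-Complex.I • (τ - τᴴ)).PosDef ↔ (of fun i j => (τ i j).im).PosDef := by
  have key : -Complex.I • (τ - τᴴ) =
      (2 : ℝ) • (of fun i j => (τ i j).im).map ((↑) : ℝ → ℂ) := by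
    ext i j
    have hij : τ j i = τ i j := congrFun (congrFun hτ i) j
    apply Complex.ext <;> simp [hij]
    ring
  rw [key, ← posDef_map_ofReal_iff]
  refine ⟨fun h => ?_, fun h => h.smul two_pos⟩
  simpa [smul_smul] using h.smul (inv_pos.2 (two_pos (α := ℝ)))

variable [DecidableEq n]

theorem isUnit_add_I_of_posDef {τ : Matrix n n ℂ} (h : (-Complex.I • (τ - τᴴ)).PosDef) :
    IsUnit (τ + Complex.I • 1) := by
  apply isUnit_of_posDef_mul_add_conjTranspose (B := -Complex.I • 1)
  have key : (τ + Complex.I • 1) * (-Complex.I • 1) +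
      (-Complex.I • (1 : Matrix n n ℂ))ᴴ * (τ + Complex.I • 1)ᴴ =
      -Complex.I • (τ - τᴴ) + 2 := by
    simp [mul_add, smul_smul, smul_sub, ← one_add_one_eq_two]
    abel
  rw [key]
  exact h.add (.ofNat 2)

theorem isUnit_one_sub_of_posDef {Z : Matrix n n ℂ} (h : (1 - Z * Zᴴ).PosDef) :
    IsUnit (1 - Z) := by
  apply isUnit_of_posDef_mul_add_conjTranspose (B := 1 + Zᴴ)
  have key : (1 - Z) * (1 + Zᴴ) + (1 + Zᴴ)ᴴ * (1 - Z)ᴴ = (1 - Z * Zᴴ) + (1 - Z * Zᴴ) := by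
    simp
    noncomm_ring
  rw [key]
  exact h.add h

theorem cayley_eq_one_sub {τ : Matrix n n ℂ} (h : IsUnit (τ + Complex.I • 1)) :
    (τ - Complex.I • 1) * (τ + Complex.I • 1)⁻¹ =
      1 - (2 * Complex.I) • (τ + Complex.I • 1)⁻¹ := by
  have hA := mul_nonsing_inv _ ((isUnit_iff_isUnit_det _).1 h)
  have : τ - Complex.I • 1 = (τ + Complex.I • 1) - (2 * Complex.I) • 1 := by
    rw [two_mul, add_smul]; abel
  rw [this, sub_mul, hA, smul_mul, one_mul]

theorem posDef_one_sub_cayley_iff {τ : Matrix n n ℂ} (h : IsUnit (τ + Complex.I • 1)) :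
    (1 - ((τ - Complex.I • 1) * (τ + Complex.I • 1)⁻¹) *
      ((τ - Complex.I • 1) * (τ + Complex.I • 1)⁻¹)ᴴ).PosDef ↔
      (-Complex.I • (τ - τᴴ)).PosDef := by
  have hAZ : (τ + Complex.I • 1) * ((τ - Complex.I • 1) * (τ + Complex.I • 1)⁻¹) =
      τ - Complex.I • 1 := by
    rw [cayley_eq_one_sub h, mul_sub, mul_smul_comm,
      mul_nonsing_inv _ ((isUnit_iff_isUnit_det _).1 h), mul_one, two_mul, add_smul]
    abel
  generalize (τ - Complex.I • 1) * (τ + Complex.I • 1)⁻¹ = Z at hAZ ⊢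
  have key : (τ + Complex.I • 1) * (1 - Z * Zᴴ) * star (τ + Complex.I • 1) =
      (2 : ℝ) • (-Complex.I • (τ - τᴴ)) := by
    have : (τ + Complex.I • 1) * (1 - Z * Zᴴ) * star (τ + Complex.I • 1) =
        (τ + Complex.I • 1) * (τ + Complex.I • 1)ᴴ -
          ((τ + Complex.I • 1) * Z) * ((τ + Complex.I • 1) * Z)ᴴ := by
      rw [conjTranspose_mul _ Z, star_eq_conjTranspose]
      noncomm_ring
    rw [this, hAZ]
    simp [add_mul, mul_add, sub_mul, smul_smul, smul_sub, two_smul]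
    abel
  rw [← IsUnit.posDef_star_right_conjugate_iff h, key]
  refine ⟨fun h => ?_, fun h => h.smul two_pos⟩
  simpa only [smul_smul, inv_mul_cancel₀ (two_ne_zero (α := ℝ)), one_smul]
    using h.smul (inv_pos.2 (two_pos (α := ℝ)))

end Matrix

/-- For every `τ ∈ ℍ_g` the matrix `τ + i·I_g` is invertible, and the Cayley transform
`Φ(τ) = (τ − i·I_g)(τ + i·I_g)⁻¹` is a bijection from `ℍ_g` onto `𝒟_g`. -/
theorem cayley_transform_bijOn (g : ℕ) (hg : 1 ≤ g) :
    (∀ τ ∈ SiegelHalfSpace g,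
      IsUnit (τ + Complex.I • (1 : Matrix (Fin g) (Fin g) ℂ))) ∧
    Set.BijOn
      (fun τ : Matrix (Fin g) (Fin g) ℂ =>
        (τ - Complex.I • 1) * (τ + Complex.I • 1)⁻¹)
      (SiegelHalfSpace g) (SiegelDomain g) := by
  have mem_iff (τ : Matrix (Fin g) (Fin g) ℂ) :
      τ ∈ SiegelHalfSpace g ↔ τᵀ = τ ∧ (-Complex.I • (τ - τᴴ)).PosDef :=
    and_congr_right fun hτ => (posDef_smul_sub_conjTranspose_iff hτ).symm
  have mem_domain_iff (Z : Matrix (Fin g) (Fin g) ℂ) :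
      Z ∈ SiegelDomain g ↔ Zᵀ = Z ∧ (1 - Z * Zᴴ).PosDef :=
    and_congr_right fun hZ => by rw [map_conj_eq_conjTranspose hZ]
  have unit : ∀ τ ∈ SiegelHalfSpace g,
      IsUnit (τ + Complex.I • (1 : Matrix (Fin g) (Fin g) ℂ)) :=
    fun τ hτ => isUnit_add_I_of_posDef ((mem_iff τ).1 hτ).2
  have two_I : 2 * Complex.I ≠ 0 := by simp
  refine ⟨unit, fun τ hτ => ?_, fun τ hτ σ hσ h => ?_, fun Z hZ => ?_⟩
  · refine (mem_domain_iff _).2 ⟨?_, (posDef_one_sub_cayley_iff (unit τ hτ)).2 ((mem_iff τ).1 hτ).2⟩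
    dsimp only
    rw [cayley_eq_one_sub (unit τ hτ)]
    simp [transpose_nonsing_inv, hτ.1]
  · dsimp only at h
    rw [cayley_eq_one_sub (unit τ hτ), cayley_eq_one_sub (unit σ hσ)] at h
    have h' := smul_right_injective _ two_I (sub_right_injective h)
    exact add_right_cancel (inv_inj h' ((isUnit_iff_isUnit_det _).1 (unit τ hτ)))
  · obtain ⟨hsymm, hpos⟩ := (mem_domain_iff Z).1 hZ
    have hu := isUnit_one_sub_of_posDef hpos
    have hdet := (isUnit_iff_isUnit_det _).1 hu
    set τ := (2 * Complex.I) • (1 - Z)⁻¹ - Complex.I • 1 with hτ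
    have hadd : τ + Complex.I • 1 = (2 * Complex.I) • (1 - Z)⁻¹ := by simp [hτ]
    have hmul : (τ + Complex.I • 1) * ((2 * Complex.I)⁻¹ • (1 - Z)) = 1 := by
      rw [hadd, smul_mul_smul_comm, mul_inv_cancel₀ two_I, nonsing_inv_mul _ hdet, one_smul]
    have hunit : IsUnit (τ + Complex.I • 1) := .of_mul_eq_one _ hmul
    have hcayley : (τ - Complex.I • 1) * (τ + Complex.I • 1)⁻¹ = Z := by
      rw [cayley_eq_one_sub hunit, inv_eq_right_inv hmul, smul_smul, mul_inv_cancel₀ two_I,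
        one_smul, sub_sub_cancel]
    refine ⟨τ, (mem_iff τ).2 ⟨?_, ?_⟩, hcayley⟩
    · simp [hτ, transpose_nonsing_inv, hsymm]
    · rw [← posDef_one_sub_cayley_iff hunit, hcayley]
      exact hpos
end

section
/- Let t be a positive integer and let d be a divisor of t with gcd(d, t/d) = 1; write t_d = t/d. Let x, y be any integers with x·d − y·t_d = 1, and define V_d ∈ M(4×4,ℝ) as (1/√d) times the matrix with rows (dx, −1, 0, 0), (−yt, d, 0, 0), (0, 0, d, yt), (0, 0, 1, dx). Then: (i) V_d ∈ Sp(4,ℝ); (ii) V_d² ∈ Γ_{1,t} (viewed inside Sp(4,ℝ)); (iii) V_d·Γ_{1,t}·V_d^{−1} = Γ_{1,t}; and (iv) the subgroup of Sp(4,ℝ) generated by Γ_{1,t} together with the elements V_d for all d with d | t, gcd(d,t/d) = 1, is independent of the choices of the integers x, y. -/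
open Matrix

/-- The standard symplectic form `J = ((0, I_2), (−I_2, 0))`. -/
def J4 (R : Type*) [CommRing R] : Matrix (Fin 4) (Fin 4) R :=
  !![0, 0, 1, 0; 0, 0, 0, 1; -1, 0, 0, 0; 0, -1, 0, 0]

/-- Membership in the paramodular group `Γ_{1,t} ⊂ Sp(4,ℚ)`: the matrix is symplectic and
its entries satisfy the integrality pattern
`(ℤ,ℤ,ℤ,tℤ; tℤ,ℤ,tℤ,tℤ; ℤ,ℤ,ℤ,tℤ; ℤ,t⁻¹ℤ,ℤ,ℤ)`. -/
def IsParamodular (t : ℕ) (M : Matrix (Fin 4) (Fin 4) ℚ) : Prop :=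
  Mᵀ * J4 ℚ * M = J4 ℚ ∧
  (∃ n : ℤ, M 0 0 = n) ∧ (∃ n : ℤ, M 0 1 = n) ∧
  (∃ n : ℤ, M 0 2 = n) ∧ (∃ n : ℤ, M 0 3 = t * n) ∧
  (∃ n : ℤ, M 1 0 = t * n) ∧ (∃ n : ℤ, M 1 1 = n) ∧
  (∃ n : ℤ, M 1 2 = t * n) ∧ (∃ n : ℤ, M 1 3 = t * n) ∧
  (∃ n : ℤ, M 2 0 = n) ∧ (∃ n : ℤ, M 2 1 = n) ∧
  (∃ n : ℤ, M 2 2 = n) ∧ (∃ n : ℤ, M 2 3 = t * n) ∧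
  (∃ n : ℤ, M 3 0 = n) ∧ (∃ n : ℤ, M 3 1 = n / t) ∧
  (∃ n : ℤ, M 3 2 = n) ∧ (∃ n : ℤ, M 3 3 = n)

/-- The real `4×4` matrices obtained from the paramodular group `Γ_{1,t} ⊂ Sp(4,ℚ)`. -/
def paramodularRealSet (t : ℕ) : Set (Matrix (Fin 4) (Fin 4) ℝ) :=
  {A | ∃ M : Matrix (Fin 4) (Fin 4) ℚ, IsParamodular t M ∧
        A = M.map (fun q : ℚ => (q : ℝ))}

/-- The matrix `V_d = (1/√d)·((dx, −1, 0, 0), (−yt, d, 0, 0), (0, 0, d, yt), (0, 0, 1, dx))`. -/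
noncomputable def VMat (t d : ℕ) (x y : ℤ) : Matrix (Fin 4) (Fin 4) ℝ :=
  (Real.sqrt d)⁻¹ •
    !![(d : ℝ) * (x : ℝ), -1, 0, 0;
       -((y : ℝ) * (t : ℝ)), (d : ℝ), 0, 0;
       0, 0, (d : ℝ), (y : ℝ) * (t : ℝ);
       0, 0, 1, (d : ℝ) * (x : ℝ)]

/-- Given a choice `c` of integers `(x_d, y_d)` for each exact divisor `d` of `t`, the
set of generators of `Γ*_{1,t}` inside `GL(4,ℝ)`: the paramodular group together with
the matrices `V_d`. -/
noncomputable def gammaStarGenerators (t : ℕ) (c : ℕ → ℤ × ℤ) : Set (GL (Fin 4) ℝ) :=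
  {g | (g : Matrix (Fin 4) (Fin 4) ℝ) ∈ paramodularRealSet t ∨
       ∃ d : ℕ, d ∣ t ∧ Nat.Coprime d (t / d) ∧
         (g : Matrix (Fin 4) (Fin 4) ℝ) = VMat t d (c d).1 (c d).2}

/-- The integral multiple `√d • V` of an Atkin–Lehner type matrix
`V = (1/√d)·((da, b, 0, 0), (tc, de, 0, 0), (0, 0, de, -tc), (0, 0, -b, da))`. -/
def atkinLehner (t d : ℕ) (a b c e : ℤ) : Matrix (Fin 4) (Fin 4) ℚ :=
  !![(d : ℚ) * a, b, 0, 0;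
     (t : ℚ) * c, (d : ℚ) * e, 0, 0;
     0, 0, (d : ℚ) * e, -((t : ℚ) * c);
     0, 0, -(b : ℚ), (d : ℚ) * a]

section AtkinLehner

variable {d f : ℕ} {a b c e : ℤ}

lemma atkinLehner_similitude (h : (d : ℤ) * a * e - f * b * c = 1) :
    (atkinLehner (d * f) d a b c e)ᵀ * J4 ℚ * atkinLehner (d * f) d a b c e = (d : ℚ) • J4 ℚ := by
  have h' : (d : ℚ) * a * e - f * b * c = 1 := by exact_mod_cast h
  ext i j
  fin_cases i <;> fin_cases j <;>
    simp [atkinLehner, J4, Matrix.mul_apply, Fin.sum_univ_four] <;>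
    first | ring1 | linear_combination (d : ℚ) * h' | linear_combination -(d : ℚ) * h'

lemma atkinLehner_mul_adjugate (h : (d : ℤ) * a * e - f * b * c = 1) :
    atkinLehner (d * f) d a b c e * atkinLehner (d * f) d e (-b) (-c) a = (d : ℚ) • 1 := by
  have h' : (d : ℚ) * a * e - f * b * c = 1 := by exact_mod_cast h
  ext i j
  fin_cases i <;> fin_cases j <;>
    simp [atkinLehner, Matrix.mul_apply, Fin.sum_univ_four] <;>
    first | ring1 | linear_combination (d : ℚ) * h'

lemma symplectic_smul_mul_mul (hd : 0 < d) {U M V : Matrix (Fin 4) (Fin 4) ℚ}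
    (hU : Uᵀ * J4 ℚ * U = (d : ℚ) • J4 ℚ) (hM : Mᵀ * J4 ℚ * M = J4 ℚ)
    (hV : Vᵀ * J4 ℚ * V = (d : ℚ) • J4 ℚ) :
    ((d : ℚ)⁻¹ • (U * M * V))ᵀ * J4 ℚ * ((d : ℚ)⁻¹ • (U * M * V)) = J4 ℚ := by
  have hd' : (d : ℚ) ≠ 0 := by positivity
  have : (U * M * V)ᵀ * J4 ℚ * (U * M * V) = Vᵀ * (Mᵀ * (Uᵀ * J4 ℚ * U) * M) * V := by
    simp only [Matrix.transpose_mul, Matrix.mul_assoc]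
  rw [Matrix.transpose_smul, Matrix.smul_mul, Matrix.smul_mul, Matrix.mul_smul, this, hU,
    Matrix.mul_smul, Matrix.smul_mul, hM, Matrix.mul_smul, Matrix.smul_mul, hV, smul_smul,
    smul_smul, smul_smul]
  field_simp
  simp

lemma isParamodular_atkinLehner_mul (hd : 0 < d) {a' b' c' e' : ℤ}
    (h : (d : ℤ) * a * e - f * b * c = 1) (h' : (d : ℤ) * a' * e' - f * b' * c' = 1) :
    IsParamodular (d * f)
      ((d : ℚ)⁻¹ • (atkinLehner (d * f) d a b c e * atkinLehner (d * f) d a' b' c' e')) := by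
  have hd' : (d : ℚ) ≠ 0 := by positivity
  refine ⟨?_, ⟨d * a * a' + f * b * c', ?_⟩, ⟨a * b' + b * e', ?_⟩, ⟨0, ?_⟩, ⟨0, ?_⟩,
    ⟨c * a' + e * c', ?_⟩, ⟨f * c * b' + d * e * e', ?_⟩, ⟨0, ?_⟩, ⟨0, ?_⟩,
    ⟨0, ?_⟩, ⟨0, ?_⟩, ⟨d * e * e' + f * c * b', ?_⟩, ⟨-(e * c' + c * a'), ?_⟩,
    ⟨0, ?_⟩, ⟨0, ?_⟩, ⟨-(b * e' + a * b'), ?_⟩, ⟨f * b * c' + d * a * a', ?_⟩⟩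
  · simpa using symplectic_smul_mul_mul hd (atkinLehner_similitude h) (M := 1) (by simp)
      (atkinLehner_similitude h')
  all_goals
    simp [atkinLehner]
  all_goals
    field_simp
    try ring

lemma isParamodular_atkinLehner_conj (hd : 0 < d) (hf : 0 < f)
    (h : (d : ℤ) * a * e - f * b * c = 1)
    {M : Matrix (Fin 4) (Fin 4) ℚ} (hM : IsParamodular (d * f) M) :
    IsParamodular (d * f)
      ((d : ℚ)⁻¹ •
        (atkinLehner (d * f) d a b c e * M * atkinLehner (d * f) d e (-b) (-c) a)) := by
  have hd' : (d : ℚ) ≠ 0 := by positivity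
  have hf' : (f : ℚ) ≠ 0 := by positivity
  obtain ⟨hJ, ⟨p, h00⟩, ⟨q, h01⟩, ⟨q₁, h02⟩, ⟨q₂, h03⟩, ⟨r, h10⟩, ⟨s, h11⟩, ⟨q₃, h12⟩, ⟨q₄, h13⟩,
    ⟨r₁, h20⟩, ⟨r₂, h21⟩, ⟨s₁, h22⟩, ⟨s₂, h23⟩, ⟨r₃, h30⟩, ⟨r₄, h31⟩, ⟨s₃, h32⟩, ⟨s₄, h33⟩⟩ := hM
  refine ⟨symplectic_smul_mul_mul hd (atkinLehner_similitude h) hJ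
      (atkinLehner_similitude (by linear_combination h)),
    ⟨e * (d * a * p + d * f * b * r) - f * c * (d * a * q + b * s), ?_⟩,
    ⟨-b * (a * p + f * b * r) + a * (d * a * q + b * s), ?_⟩,
    ⟨a * (d * a * q₁ + d * f * b * q₃) + f * b * (d * a * q₂ + b * q₄), ?_⟩,
    ⟨c * (a * q₁ + f * b * q₃) + e * (d * a * q₂ + b * q₄), ?_⟩,
    ⟨e * (c * p + d * e * r) - c * (f * c * q + e * s), ?_⟩,
    ⟨-b * (f * c * p + e * d * f * r) + a * (d * f * c * q + d * e * s), ?_⟩,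
    ⟨a * (c * q₁ + d * e * q₃) + b * (f * c * q₂ + e * q₄), ?_⟩,
    ⟨f * c * (c * q₁ + d * e * q₃) + e * (d * f * c * q₂ + d * e * q₄), ?_⟩,
    ⟨e * (d * e * r₁ - d * f * c * r₃) - f * c * (d * e * r₂ - c * r₄), ?_⟩,
    ⟨-b * (e * r₁ - f * c * r₃) + a * (d * e * r₂ - c * r₄), ?_⟩,
    ⟨a * (d * e * s₁ - d * f * c * s₃) + f * b * (d * e * s₂ - c * s₄), ?_⟩,
    ⟨c * (e * s₁ - f * c * s₃) + e * (d * e * s₂ - c * s₄), ?_⟩,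
    ⟨e * (-b * r₁ + d * a * r₃) + f * c * b * r₂ - c * a * r₄, ?_⟩,
    ⟨f * b * b * r₁ - d * f * a * b * r₃ - d * f * a * b * r₂ + d * a * a * r₄, ?_⟩,
    ⟨a * (-b * s₁ + d * a * s₃) + b * (-b * f * s₂ + a * s₄), ?_⟩,
    ⟨f * c * (-b * s₁ + d * a * s₃) + e * (-b * d * f * s₂ + d * a * s₄), ?_⟩⟩
  all_goals
    simp only [Matrix.smul_apply, Matrix.mul_apply, Fin.sum_univ_four, h00, h01, h02, h03, h10,
      h11, h12, h13, h20, h21, h22, h23, h30, h31, h32, h33]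
    simp [atkinLehner]
    field_simp
    try ring

end AtkinLehner

/-- The real Atkin–Lehner type matrix `(1/√d) • atkinLehner t d a b c e`. -/
noncomputable def realAtkinLehner (t d : ℕ) (a b c e : ℤ) : Matrix (Fin 4) (Fin 4) ℝ :=
  (Real.sqrt d)⁻¹ • (Rat.castHom ℝ).mapMatrix (atkinLehner t d a b c e)

lemma VMat_eq_realAtkinLehner (t d : ℕ) (x y : ℤ) :
    VMat t d x y = realAtkinLehner t d x (-1) (-y) 1 := by
  ext i j
  fin_cases i <;> fin_cases j <;> simp [VMat, realAtkinLehner, atkinLehner, mul_comm]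

lemma inv_sqrt_smul_mul_mul {d : ℕ} (A U V : Matrix (Fin 4) (Fin 4) ℚ) :
    ((Real.sqrt d)⁻¹ • (Rat.castHom ℝ).mapMatrix U) * (Rat.castHom ℝ).mapMatrix A *
        ((Real.sqrt d)⁻¹ • (Rat.castHom ℝ).mapMatrix V) =
      ((d : ℚ)⁻¹ • (U * A * V)).map (fun q : ℚ => (q : ℝ)) := by
  have h : (Real.sqrt d)⁻¹ * (Real.sqrt d)⁻¹ = (d : ℝ)⁻¹ := by
    rw [← mul_inv, Real.mul_self_sqrt d.cast_nonneg]
  have hmap : ((d : ℚ)⁻¹ • (U * A * V)).map (fun q : ℚ => (q : ℝ)) =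
      (d : ℝ)⁻¹ • (Rat.castHom ℝ).mapMatrix (U * A * V) := by
    ext i j
    simp
  rw [hmap, map_mul, map_mul, Matrix.smul_mul, Matrix.smul_mul, Matrix.mul_smul, smul_smul, h]

section RealAtkinLehner

variable {d f : ℕ} {a b c e : ℤ}

lemma realAtkinLehner_mul_mem (hd : 0 < d) {a' b' c' e' : ℤ}
    (h : (d : ℤ) * a * e - f * b * c = 1) (h' : (d : ℤ) * a' * e' - f * b' * c' = 1) :
    realAtkinLehner (d * f) d a b c e * realAtkinLehner (d * f) d a' b' c' e' ∈
      paramodularRealSet (d * f) := by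
  refine ⟨_, isParamodular_atkinLehner_mul hd h h', ?_⟩
  simpa [realAtkinLehner] using inv_sqrt_smul_mul_mul (d := d) 1 (atkinLehner (d * f) d a b c e)
    (atkinLehner (d * f) d a' b' c' e')

lemma realAtkinLehner_conj_mem (hd : 0 < d) (hf : 0 < f)
    (h : (d : ℤ) * a * e - f * b * c = 1) {A : Matrix (Fin 4) (Fin 4) ℝ}
    (hA : A ∈ paramodularRealSet (d * f)) :
    realAtkinLehner (d * f) d a b c e * A * realAtkinLehner (d * f) d e (-b) (-c) a ∈
      paramodularRealSet (d * f) := by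
  obtain ⟨M, hM, rfl⟩ := hA
  exact ⟨_, isParamodular_atkinLehner_conj hd hf h hM, inv_sqrt_smul_mul_mul _ _ _⟩

lemma realAtkinLehner_mul_adjugate (hd : 0 < d) (h : (d : ℤ) * a * e - f * b * c = 1) :
    realAtkinLehner (d * f) d a b c e * realAtkinLehner (d * f) d e (-b) (-c) a = 1 := by
  have hd' : (d : ℚ) ≠ 0 := by positivity
  have := inv_sqrt_smul_mul_mul (d := d) 1 (atkinLehner (d * f) d a b c e)
    (atkinLehner (d * f) d e (-b) (-c) a)
  rw [map_one, Matrix.mul_one, Matrix.mul_one, atkinLehner_mul_adjugate h, smul_smul,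
    inv_mul_cancel₀ hd', one_smul] at this
  simpa [realAtkinLehner] using this

lemma realAtkinLehner_adjugate_mul (hd : 0 < d) (h : (d : ℤ) * a * e - f * b * c = 1) :
    realAtkinLehner (d * f) d e (-b) (-c) a * realAtkinLehner (d * f) d a b c e = 1 :=
  mul_eq_one_comm.mp (realAtkinLehner_mul_adjugate hd h)

lemma realAtkinLehner_inv (hd : 0 < d) (h : (d : ℤ) * a * e - f * b * c = 1) :
    (realAtkinLehner (d * f) d a b c e)⁻¹ = realAtkinLehner (d * f) d e (-b) (-c) a :=
  Matrix.inv_eq_right_inv (realAtkinLehner_mul_adjugate hd h)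

lemma realAtkinLehner_symplectic (hd : 0 < d) (h : (d : ℤ) * a * e - f * b * c = 1) :
    (realAtkinLehner (d * f) d a b c e)ᵀ * J4 ℝ * realAtkinLehner (d * f) d a b c e = J4 ℝ := by
  have hd' : (d : ℚ) ≠ 0 := by positivity
  have hJ : (Rat.castHom ℝ).mapMatrix (J4 ℚ) = J4 ℝ := by
    ext i j
    fin_cases i <;> fin_cases j <;> simp [J4]
  have := inv_sqrt_smul_mul_mul (d := d) (J4 ℚ) (atkinLehner (d * f) d a b c e)ᵀ
    (atkinLehner (d * f) d a b c e)
  rw [atkinLehner_similitude h, smul_smul, inv_mul_cancel₀ hd', one_smul, hJ] at this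
  exact this.trans hJ

lemma realAtkinLehner_conj_image (hd : 0 < d) (hf : 0 < f)
    (h : (d : ℤ) * a * e - f * b * c = 1) :
    (fun A => realAtkinLehner (d * f) d a b c e * A * (realAtkinLehner (d * f) d a b c e)⁻¹) ''
      paramodularRealSet (d * f) = paramodularRealSet (d * f) := by
  rw [realAtkinLehner_inv hd h]
  have hadj : (d : ℤ) * e * a - f * -b * -c = 1 := by linear_combination h
  refine Set.Subset.antisymm ?_ fun A hA => ?_
  · rintro _ ⟨A, hA, rfl⟩
    exact realAtkinLehner_conj_mem hd hf h hA
  · refine ⟨_, realAtkinLehner_conj_mem hd hf hadj hA, ?_⟩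
    have h₁ := realAtkinLehner_mul_adjugate hd h
    simp only [neg_neg, Matrix.mul_assoc, h₁, Matrix.mul_one]
    rw [← Matrix.mul_assoc, h₁, Matrix.one_mul]

end RealAtkinLehner

lemma bezout_rearrange {d f : ℕ} {x y : ℤ} (h : x * (d : ℤ) - y * (f : ℤ) = 1) :
    (d : ℤ) * x * 1 - f * (-1) * (-y) = 1 := by
  linear_combination h

lemma closure_gammaStarGenerators_le {t : ℕ} (ht : 0 < t) {c c' : ℕ → ℤ × ℤ}
    (hc : ∀ d : ℕ, d ∣ t → Nat.Coprime d (t / d) →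
      (c d).1 * (d : ℤ) - (c d).2 * ((t / d : ℕ) : ℤ) = 1)
    (hc' : ∀ d : ℕ, d ∣ t → Nat.Coprime d (t / d) →
      (c' d).1 * (d : ℤ) - (c' d).2 * ((t / d : ℕ) : ℤ) = 1) :
    Subgroup.closure (gammaStarGenerators t c) ≤ Subgroup.closure (gammaStarGenerators t c') := by
  rw [Subgroup.closure_le]
  rintro g (hg | ⟨d, hdt, hcop, hg⟩)
  · exact Subgroup.subset_closure (Or.inl hg)
  have hb := hc d hdt hcop
  have hb' := hc' d hdt hcop
  have hd : 0 < d := Nat.pos_of_dvd_of_pos hdt ht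
  obtain ⟨f, rfl⟩ := id hdt
  rw [Nat.mul_div_cancel_left f hd] at hb hb'
  replace hb := bezout_rearrange hb
  replace hb' := bezout_rearrange hb'
  let u : GL (Fin 4) ℝ :=
    ⟨_, _, realAtkinLehner_mul_adjugate hd hb', realAtkinLehner_adjugate_mul hd hb'⟩
  have hu : u ∈ Subgroup.closure (gammaStarGenerators (d * f) c') :=
    Subgroup.subset_closure (Or.inr ⟨d, hdt, hcop, (VMat_eq_realAtkinLehner _ _ _ _).symm⟩)
  have hgu : g * u⁻¹ ∈ Subgroup.closure (gammaStarGenerators (d * f) c') := by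
    refine Subgroup.subset_closure (Or.inl ?_)
    rw [Units.val_mul, hg, VMat_eq_realAtkinLehner]
    exact realAtkinLehner_mul_mem hd hb (by linear_combination hb')
  simpa using mul_mem hgu hu

/-- For an exact divisor `d ∥ t` and integers `x, y` with `xd − y(t/d) = 1`:
(i) `V_d ∈ Sp(4,ℝ)`; (ii) `V_d² ∈ Γ_{1,t}`; (iii) `V_d Γ_{1,t} V_d⁻¹ = Γ_{1,t}`;
(iv) the subgroup of `Sp(4,ℝ)` generated by `Γ_{1,t}` and the `V_d` does not depend on
the choices of the integers `x, y`. -/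
theorem Vd_properties (t : ℕ) (ht : 0 < t) :
    (∀ (d : ℕ), d ∣ t → Nat.Coprime d (t / d) →
      ∀ x y : ℤ, x * (d : ℤ) - y * ((t / d : ℕ) : ℤ) = 1 →
        ((VMat t d x y)ᵀ * J4 ℝ * VMat t d x y = J4 ℝ) ∧
        (∃ M : Matrix (Fin 4) (Fin 4) ℚ, IsParamodular t M ∧
          VMat t d x y * VMat t d x y = M.map (fun q : ℚ => (q : ℝ))) ∧
        ((fun A => VMat t d x y * A * (VMat t d x y)⁻¹) '' paramodularRealSet t =
          paramodularRealSet t)) ∧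
    (∀ c c' : ℕ → ℤ × ℤ,
      (∀ d : ℕ, d ∣ t → Nat.Coprime d (t / d) →
        (c d).1 * (d : ℤ) - (c d).2 * ((t / d : ℕ) : ℤ) = 1) →
      (∀ d : ℕ, d ∣ t → Nat.Coprime d (t / d) →
        (c' d).1 * (d : ℤ) - (c' d).2 * ((t / d : ℕ) : ℤ) = 1) →
      Subgroup.closure (gammaStarGenerators t c) =
        Subgroup.closure (gammaStarGenerators t c')) := by
  refine ⟨fun d hdt _ x y hxy => ?_, fun c c' hc hc' =>
    le_antisymm (closure_gammaStarGenerators_le ht hc hc')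
      (closure_gammaStarGenerators_le ht hc' hc)⟩
  have hd : 0 < d := Nat.pos_of_dvd_of_pos hdt ht
  obtain ⟨f, rfl⟩ := hdt
  have hf : 0 < f := Nat.pos_of_mul_pos_left ht
  rw [Nat.mul_div_cancel_left f hd] at hxy
  have h := bezout_rearrange hxy
  rw [VMat_eq_realAtkinLehner]
  exact ⟨realAtkinLehner_symplectic hd h, realAtkinLehner_mul_mem hd h h,
    realAtkinLehner_conj_image hd hf h⟩
end

section
/- Let t be a positive integer and let ν(t) be the number of distinct prime divisors of t. For each divisor d of t with gcd(d, t/d) = 1 choose integers x_d, y_d with x_d·d − y_d·(t/d) = 1 and let V_d ∈ Sp(4,ℝ) be the corresponding matrix (1/√d)·((dx_d, −1, 0, 0), (−y_d t, d, 0, 0), (0, 0, d, y_d t), (0, 0, 1, d x_d)). Let Γ*_{1,t} be the subgroup of Sp(4,ℝ) generated by Γ_{1,t} together with all these V_d. Then Γ_{1,t} is a normal subgroup of Γ*_{1,t} and the quotient Γ*_{1,t}/Γ_{1,t} is isomorphic to (ℤ/2ℤ)^{ν(t)}. -/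
open Matrix

/-- The fractional ideals containing the entries of `√d • A`, for `A` in the coset of
`V_d` modulo `Γ_{1,de}`. -/
noncomputable def cosetScale (d e : ℝ) : Matrix (Fin 4) (Fin 4) ℝ :=
  !![d, 1, d, d * e;
     d * e, d, d * e, d ^ 2 * e;
     d, 1, d, d * e;
     1, e⁻¹, 1, d]

/-- Explicit description of the coset of `V_d` modulo `Γ_{1,t}`, where `t = d * e`. -/
def IsInCoset (d e : ℕ) (A : Matrix (Fin 4) (Fin 4) ℝ) : Prop :=
  Aᵀ * J4 ℝ * A = J4 ℝ ∧
  ∃ n : Matrix (Fin 4) (Fin 4) ℤ, ∀ i j, √d * A i j = cosetScale d e i j * n i j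

theorem cosetScale_mul (a b c r : ℕ) (ha : 0 < a) (hb : 0 < b) (hc : 0 < c) (hr : 0 < r)
    (i k j : Fin 4) :
    ∃ z : ℤ, cosetScale (c * a : ℕ) (b * r : ℕ) i k * cosetScale (c * b : ℕ) (a * r : ℕ) k j =
      c * cosetScale (a * b : ℕ) (c * r : ℕ) i j * z := by
  have ha' : (a : ℝ) ≠ 0 := by positivity
  have hb' : (b : ℝ) ≠ 0 := by positivity
  have hc' : (c : ℝ) ≠ 0 := by positivity
  have hr' : (r : ℝ) ≠ 0 := by positivity
  fin_cases i <;> fin_cases k <;> fin_cases j <;>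
    simp [cosetScale, hc.ne'] <;>
  first
  | (refine ⟨a, ?_⟩; push_cast; (try field_simp); done)
  | (refine ⟨b, ?_⟩; push_cast; (try field_simp); done)
  | (refine ⟨c, ?_⟩; push_cast; (try field_simp); done)
  | (refine ⟨r, ?_⟩; push_cast; field_simp)

theorem IsInCoset.mul {a b c r : ℕ} (ha : 0 < a) (hb : 0 < b) (hc : 0 < c) (hr : 0 < r)
    {A B : Matrix (Fin 4) (Fin 4) ℝ} (hA : IsInCoset (c * a) (b * r) A)
    (hB : IsInCoset (c * b) (a * r) B) : IsInCoset (a * b) (c * r) (A * B) := by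
  obtain ⟨hA, m, hm⟩ := hA
  obtain ⟨hB, n, hn⟩ := hB
  refine ⟨?_, ?_⟩
  · calc (A * B)ᵀ * J4 ℝ * (A * B) = Bᵀ * (Aᵀ * J4 ℝ * A) * B := by
          simp only [transpose_mul, Matrix.mul_assoc]
      _ = J4 ℝ := by rw [hA, hB]
  · choose z hz using cosetScale_mul a b c r ha hb hc hr
    refine ⟨fun i j => ∑ k, z i k j * (m i k * n k j), fun i j => ?_⟩
    have hsqrt : √(c * a : ℕ) * √(c * b : ℕ) = c * √(a * b : ℕ) := by
      rw [← Real.sqrt_mul (by positivity)]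
      have h : ((c * a : ℕ) : ℝ) * (c * b : ℕ) = (c : ℝ) ^ 2 * (a * b : ℕ) := by
        push_cast; ring
      rw [h, Real.sqrt_mul (by positivity), Real.sqrt_sq (by positivity)]
    have hc' : (c : ℝ) ≠ 0 := by positivity
    apply mul_left_cancel₀ hc'
    rw [← mul_assoc, ← hsqrt, Matrix.mul_apply, Finset.mul_sum]
    simp only [Int.cast_sum, Int.cast_mul]
    rw [Finset.mul_sum, Finset.mul_sum]
    refine Finset.sum_congr rfl fun k _ => ?_
    calc √(c * a : ℕ) * √(c * b : ℕ) * (A i k * B k j)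
        = (√(c * a : ℕ) * A i k) * (√(c * b : ℕ) * B k j) := by ring
      _ = (cosetScale (c * a : ℕ) (b * r : ℕ) i k * cosetScale (c * b : ℕ) (a * r : ℕ) k j) *
            (m i k * n k j) := by rw [hm, hn]; ring
      _ = _ := by rw [hz]; ring

theorem J4_mul_self (R : Type*) [CommRing R] : J4 R * J4 R = -1 := by
  ext i j
  fin_cases i <;> fin_cases j <;> simp [J4, Matrix.mul_apply, Fin.sum_univ_four]

theorem IsInCoset.inv {d e : ℕ} {g : GL (Fin 4) ℝ} (hg : IsInCoset d e g) :
    IsInCoset d e (g⁻¹ : GL (Fin 4) ℝ) := by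
  obtain ⟨hA, n, hn⟩ := hg
  set A : Matrix (Fin 4) (Fin 4) ℝ := g.val
  have hinv : ((g⁻¹ : GL (Fin 4) ℝ) : Matrix (Fin 4) (Fin 4) ℝ) = -(J4 ℝ * Aᵀ * J4 ℝ) := by
    refine Units.inv_eq_of_mul_eq_one_left ?_
    calc -(J4 ℝ * Aᵀ * J4 ℝ) * A = -(J4 ℝ * (Aᵀ * J4 ℝ * A)) := by
          simp only [Matrix.neg_mul, Matrix.mul_assoc]
      _ = 1 := by rw [hA, J4_mul_self, neg_neg]
  refine ⟨?_, ?_⟩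
  · have h1 : A * ((g⁻¹ : GL (Fin 4) ℝ) : Matrix (Fin 4) (Fin 4) ℝ) = 1 := g.mul_inv
    set B : Matrix (Fin 4) (Fin 4) ℝ := ((g⁻¹ : GL (Fin 4) ℝ) : Matrix (Fin 4) (Fin 4) ℝ)
    calc Bᵀ * J4 ℝ * B = Bᵀ * (Aᵀ * J4 ℝ * A) * B := by rw [hA]
      _ = (A * B)ᵀ * J4 ℝ * (A * B) := by simp only [transpose_mul, Matrix.mul_assoc]
      _ = J4 ℝ := by simp [h1]
  · rw [hinv]
    refine ⟨!![n 2 2, n 3 2, -n 0 2, -n 1 2; n 2 3, n 3 3, -n 0 3, -n 1 3;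
      -n 2 0, -n 3 0, n 0 0, n 1 0; -n 2 1, -n 3 1, n 0 1, n 1 1], fun i j => ?_⟩
    fin_cases i <;> fin_cases j <;>
      simp [J4, Matrix.mul_apply, Matrix.vecMul, dotProduct, Fin.sum_univ_four, hn] <;>
      simp [cosetScale]

theorem IsInCoset.eq_one_of_one {d e : ℕ} (hd : 0 < d) (h : IsInCoset d e 1) : d = 1 := by
  obtain ⟨-, n, hn⟩ := h
  have h0 : √d = d * n 0 0 := by simpa [cosetScale] using hn 0 0
  have h1 : (d : ℝ) = d * (d * (n 0 0 : ℝ) ^ 2) := by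
    calc (d : ℝ) = √d ^ 2 := (Real.sq_sqrt (by positivity)).symm
      _ = _ := by rw [h0]; ring
  have hd' : (d : ℝ) ≠ 0 := by positivity
  have h2 : (d : ℝ) * (n 0 0 : ℝ) ^ 2 = 1 := mul_left_cancel₀ hd' (by rw [← h1, mul_one])
  have h3 : (d : ℤ) * (n 0 0) ^ 2 = 1 := by exact_mod_cast h2
  exact_mod_cast Int.eq_one_of_mul_eq_one_right (by positivity) h3

theorem isInCoset_one_iff {t : ℕ} (A : Matrix (Fin 4) (Fin 4) ℝ) :
    IsInCoset 1 t A ↔ A ∈ paramodularRealSet t := by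
  have hJ : (J4 ℚ).map (Rat.castHom ℝ) = J4 ℝ := by
    ext i j
    fin_cases i <;> fin_cases j <;> simp [J4]
  have hsymp (M : Matrix (Fin 4) (Fin 4) ℚ) : Mᵀ * J4 ℚ * M = J4 ℚ ↔
      (M.map (Rat.castHom ℝ))ᵀ * J4 ℝ * M.map (Rat.castHom ℝ) = J4 ℝ := by
    rw [← hJ, ← transpose_map, ← Matrix.map_mul, ← Matrix.map_mul]
    exact (Matrix.map_injective (Rat.castHom ℝ).injective).eq_iff.symm
  constructor
  · rintro ⟨hA, n, hn⟩
    let M : Matrix (Fin 4) (Fin 4) ℚ :=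
      !![(n 0 0 : ℚ), n 0 1, n 0 2, t * n 0 3; t * n 1 0, n 1 1, t * n 1 2, t * n 1 3;
        n 2 0, n 2 1, n 2 2, t * n 2 3; n 3 0, n 3 1 / t, n 3 2, n 3 3]
    have hM : A = M.map (Rat.castHom ℝ) := by
      ext i j
      have h := hn i j
      rw [Nat.cast_one, Real.sqrt_one, one_mul] at h
      rw [h]
      fin_cases i <;> fin_cases j <;> simp [cosetScale, M, div_eq_inv_mul]
    refine ⟨M, ⟨(hsymp M).2 (hM ▸ hA), ?_⟩, hM⟩
    refine ⟨⟨n 0 0, ?_⟩, ⟨n 0 1, ?_⟩, ⟨n 0 2, ?_⟩, ⟨n 0 3, ?_⟩,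
      ⟨n 1 0, ?_⟩, ⟨n 1 1, ?_⟩, ⟨n 1 2, ?_⟩, ⟨n 1 3, ?_⟩,
      ⟨n 2 0, ?_⟩, ⟨n 2 1, ?_⟩, ⟨n 2 2, ?_⟩, ⟨n 2 3, ?_⟩,
      ⟨n 3 0, ?_⟩, ⟨n 3 1, ?_⟩, ⟨n 3 2, ?_⟩, ⟨n 3 3, ?_⟩⟩ <;> simp [M]
  · rintro ⟨M, ⟨hM, ⟨n00, h00⟩, ⟨n01, h01⟩, ⟨n02, h02⟩, ⟨n03, h03⟩,
      ⟨n10, h10⟩, ⟨n11, h11⟩, ⟨n12, h12⟩, ⟨n13, h13⟩,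
      ⟨n20, h20⟩, ⟨n21, h21⟩, ⟨n22, h22⟩, ⟨n23, h23⟩,
      ⟨n30, h30⟩, ⟨n31, h31⟩, ⟨n32, h32⟩, ⟨n33, h33⟩⟩, rfl⟩
    refine ⟨(hsymp M).1 hM, !![n00, n01, n02, n03; n10, n11, n12, n13;
      n20, n21, n22, n23; n30, n31, n32, n33], fun i j => ?_⟩
    fin_cases i <;> fin_cases j <;> simp [cosetScale, *, div_eq_inv_mul]

theorem isInCoset_VMat {d e : ℕ} (hd : 0 < d) (he : 0 < e) {x y : ℤ}
    (hxy : x * (d : ℤ) - y * (e : ℤ) = 1) : IsInCoset d e (VMat (d * e) d x y) := by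
  have hs : √(d : ℝ) ≠ 0 := by positivity
  have hs2 : √(d : ℝ) ^ 2 = d := Real.sq_sqrt (by positivity)
  have hxy' : (x : ℝ) * d - y * e = 1 := by exact_mod_cast hxy
  have he' : (e : ℝ) ≠ 0 := by positivity
  refine ⟨?_, !![x, -1, 0, 0; -y, 1, 0, 0; 0, 0, 1, y; 0, 0, 1, x], fun i j => ?_⟩
  · ext i j
    fin_cases i <;> fin_cases j <;>
      simp [VMat, J4, Matrix.mul_apply, Fin.sum_univ_four] <;> field_simp <;> rw [hs2] <;>
      first
      | linear_combination (d : ℝ) * hxy'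
      | linear_combination -(d : ℝ) * hxy'
      | ring
  · fin_cases i <;> fin_cases j <;> simp [VMat, cosetScale] <;> field_simp

theorem det_ne_zero_of_symplectic {A : Matrix (Fin 4) (Fin 4) ℝ}
    (hA : Aᵀ * J4 ℝ * A = J4 ℝ) : A.det ≠ 0 := by
  have hJ : (J4 ℝ).det ≠ 0 := by
    intro h
    have := congrArg det (J4_mul_self ℝ)
    norm_num [h, det_neg] at this
  intro h
  apply hJ
  rw [← hA, det_mul, h, mul_zero]

theorem exists_common_factorization {d d' t : ℕ} (ht : 0 < t) (hd : d ∣ t) (hd' : d' ∣ t) :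
    ∃ a b c r : ℕ, 0 < a ∧ 0 < b ∧ 0 < c ∧ 0 < r ∧
      d = c * a ∧ d' = c * b ∧ t = a * b * (c * r) := by
  have hc : 0 < d.gcd d' := Nat.gcd_pos_of_pos_left _ (Nat.pos_of_dvd_of_pos hd ht)
  obtain ⟨a, b, -, ha, hb⟩ := Nat.exists_coprime d d'
  obtain ⟨r, hr⟩ := Nat.lcm_dvd hd hd'
  have hlcm : d.lcm d' = a * b * d.gcd d' := by
    apply Nat.eq_of_mul_eq_mul_left hc
    rw [Nat.gcd_mul_lcm]
    nth_rw 1 [ha]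
    nth_rw 2 [hb]
    ring
  have htt : t = a * b * (d.gcd d' * r) := by rw [hr, hlcm]; ring
  refine ⟨a, b, d.gcd d', r, ?_, ?_, hc, ?_, by rw [mul_comm]; exact ha,
    by rw [mul_comm]; exact hb, htt⟩ <;>
  · apply Nat.pos_of_ne_zero
    rintro rfl
    simp at htt
    omega

theorem IsInCoset.unique {d e d' e' t : ℕ} (ht : 0 < t) (h : t = d * e) (h' : t = d' * e')
    {g : GL (Fin 4) ℝ} (hg : IsInCoset d e g) (hg' : IsInCoset d' e' g) : d = d' := by
  obtain ⟨a, b, c, r, ha, hb, hc, hr, rfl, rfl, habcr⟩ :=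
    exists_common_factorization ht ⟨e, h⟩ ⟨e', h'⟩
  obtain rfl : e = b * r := Nat.eq_of_mul_eq_mul_left (Nat.mul_pos hc ha) (by
    rw [← h, habcr]; ring)
  obtain rfl : e' = a * r := Nat.eq_of_mul_eq_mul_left (Nat.mul_pos hc hb) (by
    rw [← h', habcr]; ring)
  have h1 := hg.inv.mul ha hb hc hr hg'
  rw [g.inv_mul] at h1
  have hab := h1.eq_one_of_one (Nat.mul_pos ha hb)
  rw [Nat.eq_one_of_mul_eq_one_right hab, Nat.eq_one_of_mul_eq_one_left hab]

theorem exists_coprime_factorization (t : ℕ) (ht : 0 < t) (P : ℕ → Prop) :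
    ∃ d e : ℕ, t = d * e ∧ d.Coprime e ∧ ∀ p ∈ t.primeFactors, p ∣ d ↔ P p := by
  classical
  let f : ℕ → ℕ := fun p => p ^ t.factorization p
  have hdvd (p : ℕ) (hp : p ∈ t.primeFactors) (Q : ℕ → Prop) [DecidablePred Q] :
      p ∣ ∏ q ∈ t.primeFactors with Q q, f q ↔ Q p := by
    have hpp := Nat.prime_of_mem_primeFactors hp
    rw [hpp.prime.dvd_finsetProd_iff]
    constructor
    · rintro ⟨q, hq, hpq⟩
      rw [Finset.mem_filter] at hq
      have := (Nat.prime_dvd_prime_iff_eq hpp (Nat.prime_of_mem_primeFactors hq.1)).1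
        (hpp.dvd_of_dvd_pow hpq)
      exact this ▸ hq.2
    · intro hQ
      refine ⟨p, Finset.mem_filter.2 ⟨hp, hQ⟩, dvd_pow_self p ?_⟩
      exact (hpp.factorization_pos_of_dvd ht.ne' (Nat.dvd_of_mem_primeFactors hp)).ne'
  have hprod : t = (∏ q ∈ t.primeFactors with P q, f q) *
      ∏ q ∈ t.primeFactors with ¬ P q, f q := by
    rw [Finset.prod_filter_mul_prod_filter_not]
    exact (Nat.prod_factorization_pow_eq_self ht.ne').symm
  refine ⟨_, _, hprod, ?_, fun p hp => hdvd p hp P⟩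
  refine Nat.Coprime.symm (Nat.coprime_of_dvd fun p hpp h1 h2 => ?_)
  have hp : p ∈ t.primeFactors :=
    Nat.mem_primeFactors.2 ⟨hpp, hprod ▸ Dvd.dvd.mul_right h2 _, ht.ne'⟩
  exact (hdvd p hp _).1 h1 ((hdvd p hp _).1 h2)

theorem ite_dvd_mul_eq_add {a b c r p : ℕ} (hp : p.Prime) (h : (c * a).Coprime (b * r))
    (h' : (c * b).Coprime (a * r)) :
    (if p ∣ a * b then 1 else 0 : ZMod 2) =
      (if p ∣ c * a then 1 else 0) + (if p ∣ c * b then 1 else 0) := by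
  have hn : ¬ (p ∣ c * a ∧ p ∣ b * r) := fun ⟨h1, h2⟩ =>
    Nat.not_coprime_of_dvd_of_dvd hp.one_lt h1 h2 h
  have hn' : ¬ (p ∣ c * b ∧ p ∣ a * r) := fun ⟨h1, h2⟩ =>
    Nat.not_coprime_of_dvd_of_dvd hp.one_lt h1 h2 h'
  simp only [hp.dvd_mul] at hn hn' ⊢
  have h2 : (1 + 1 : ZMod 2) = 0 := by decide
  by_cases ha : p ∣ a <;> by_cases hb : p ∣ b <;> by_cases hc : p ∣ c <;> simp_all

/-- The elements of `Γ*_{1,t}` all lie in one of the cosets of the `V_d`. -/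
theorem exists_isInCoset_of_mem_closure {t : ℕ} (ht : 0 < t) {c : ℕ → ℤ × ℤ}
    (hc : ∀ d : ℕ, d ∣ t → Nat.Coprime d (t / d) →
      (c d).1 * (d : ℤ) - (c d).2 * ((t / d : ℕ) : ℤ) = 1)
    {g : GL (Fin 4) ℝ} (hg : g ∈ Subgroup.closure (gammaStarGenerators t c)) :
    ∃ d e : ℕ, t = d * e ∧ d.Coprime e ∧ IsInCoset d e g := by
  induction hg using Subgroup.closure_induction with
  | mem g hg =>
    rcases hg with hg | ⟨d, hd, hcop, hg⟩
    · exact ⟨1, t, (one_mul t).symm, Nat.coprime_one_left t, (isInCoset_one_iff _).2 hg⟩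
    · have hde : t = d * (t / d) := (Nat.mul_div_cancel' hd).symm
      refine ⟨d, t / d, hde, hcop, ?_⟩
      rw [hg]
      have h := isInCoset_VMat (Nat.pos_of_dvd_of_pos hd ht)
        (Nat.div_pos (Nat.le_of_dvd ht hd) (Nat.pos_of_dvd_of_pos hd ht)) (hc d hd hcop)
      rwa [← hde] at h
  | one =>
    refine ⟨1, t, (one_mul t).symm, Nat.coprime_one_left t, by simp, 1, fun i j => ?_⟩
    fin_cases i <;> fin_cases j <;> simp [cosetScale]
  | inv g _ ih =>
    obtain ⟨d, e, h, hcop, hg⟩ := ih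
    exact ⟨d, e, h, hcop, hg.inv⟩
  | mul g g' _ _ ih ih' =>
    obtain ⟨d, e, h, hcop, hg⟩ := ih
    obtain ⟨d', e', h', hcop', hg'⟩ := ih'
    obtain ⟨a, b, c, r, ha, hb, hc, hr, rfl, rfl, habcr⟩ :=
      exists_common_factorization ht ⟨e, h⟩ ⟨e', h'⟩
    obtain rfl : e = b * r := Nat.eq_of_mul_eq_mul_left (Nat.mul_pos hc ha) (by
      rw [← h, habcr]; ring)
    obtain rfl : e' = a * r := Nat.eq_of_mul_eq_mul_left (Nat.mul_pos hc hb) (by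
      rw [← h', habcr]; ring)
    refine ⟨a * b, c * r, habcr, ?_, hg.mul ha hb hc hr hg'⟩
    simp only [Nat.coprime_mul_iff_left, Nat.coprime_mul_iff_right] at hcop hcop' ⊢
    exact ⟨⟨hcop'.1.1.symm, hcop.1.1.symm⟩, ⟨hcop.2.2, hcop'.2.2⟩⟩

/-- `Γ_{1,t}` is a normal subgroup of `Γ*_{1,t}` and the quotient `Γ*_{1,t}/Γ_{1,t}` is
isomorphic to `(ℤ/2ℤ)^{ν(t)}`, where `ν(t)` is the number of distinct prime divisors of
`t`.  (The quotient is expressed via a surjective homomorphism with kernel `Γ_{1,t}`.) -/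
theorem gammaStar_quotient_paramodular (t : ℕ) (ht : 0 < t) (c : ℕ → ℤ × ℤ)
    (hc : ∀ d : ℕ, d ∣ t → Nat.Coprime d (t / d) →
      (c d).1 * (d : ℤ) - (c d).2 * ((t / d : ℕ) : ℤ) = 1)
    (Γ : Subgroup (GL (Fin 4) ℝ))
    (hΓ : ∀ g : GL (Fin 4) ℝ, g ∈ Γ ↔
      (g : Matrix (Fin 4) (Fin 4) ℝ) ∈ paramodularRealSet t) :
    (Γ.subgroupOf (Subgroup.closure (gammaStarGenerators t c))).Normal ∧
    ∃ f : Subgroup.closure (gammaStarGenerators t c) →*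
        Multiplicative (Fin t.primeFactors.card → ZMod 2),
      Function.Surjective f ∧
      f.ker = Γ.subgroupOf (Subgroup.closure (gammaStarGenerators t c)) := by
  have key : ∃ f : Subgroup.closure (gammaStarGenerators t c) →*
        Multiplicative (Fin t.primeFactors.card → ZMod 2),
      Function.Surjective f ∧
      f.ker = Γ.subgroupOf (Subgroup.closure (gammaStarGenerators t c)) := by
    choose δ ε hδε hcop hδ using fun g : Subgroup.closure (gammaStarGenerators t c) =>
      exists_isInCoset_of_mem_closure ht hc g.2
    let q : Fin t.primeFactors.card → ℕ := fun i => t.primeFactors.equivFin.symm i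
    have hq (i) : q i ∈ t.primeFactors := (t.primeFactors.equivFin.symm i).2
    have hq' (p : ℕ) (hp : p ∈ t.primeFactors) : ∃ i, q i = p :=
      ⟨t.primeFactors.equivFin ⟨p, hp⟩, by simp [q]⟩
    let f : Subgroup.closure (gammaStarGenerators t c) →*
        Multiplicative (Fin t.primeFactors.card → ZMod 2) :=
      MonoidHom.mk' (fun g => Multiplicative.ofAdd fun i => if q i ∣ δ g then 1 else 0) (by
        intro g g'
        obtain ⟨a, b, c, r, ha, hb, hc, hr, h1, h2, habcr⟩ :=
          exists_common_factorization ht ⟨_, hδε g⟩ ⟨_, hδε g'⟩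
        have h3 : ε g = b * r := Nat.eq_of_mul_eq_mul_left (Nat.mul_pos hc ha) (by
          rw [← h1, ← hδε g, habcr]; rw [h1]; ring)
        have h4 : ε g' = a * r := Nat.eq_of_mul_eq_mul_left (Nat.mul_pos hc hb) (by
          rw [← h2, ← hδε g', habcr]; rw [h2]; ring)
        have hg := hδ g
        have hg' := hδ g'
        have hcg := hcop g
        have hcg' := hcop g'
        rw [h1, h3] at hg hcg
        rw [h2, h4] at hg' hcg'
        have h5 : δ (g * g') = a * b :=
          (hδ (g * g')).unique ht (hδε _) habcr (hg.mul ha hb hc hr hg')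
        rw [← ofAdd_add]
        congr 1
        funext i
        rw [Pi.add_apply, h5, h1, h2]
        exact ite_dvd_mul_eq_add (Nat.prime_of_mem_primeFactors (hq i)) hcg hcg')
    refine ⟨f, fun s => ?_, ?_⟩
    · obtain ⟨d, e, hde, hcde, hd⟩ := exists_coprime_factorization t ht
        fun p => ∃ i, q i = p ∧ Multiplicative.toAdd s i = 1
      have hd0 : 0 < d := Nat.pos_of_dvd_of_pos ⟨e, hde⟩ ht
      have he0 : 0 < e := Nat.pos_of_dvd_of_pos ⟨d, by rw [hde, mul_comm]⟩ ht
      have hte : t / d = e := by rw [hde, Nat.mul_div_cancel_left _ hd0]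
      have hV : IsInCoset d e (VMat t d (c d).1 (c d).2) := by
        have h := hc d ⟨e, hde⟩ (hte ▸ hcde)
        rw [hte] at h
        rw [hde]
        exact isInCoset_VMat hd0 he0 h
      let v := Matrix.GeneralLinearGroup.mkOfDetNeZero _ (det_ne_zero_of_symplectic hV.1)
      have hv : v ∈ Subgroup.closure (gammaStarGenerators t c) :=
        Subgroup.subset_closure (Or.inr ⟨d, ⟨e, hde⟩, hte ▸ hcde, rfl⟩)
      refine ⟨⟨v, hv⟩, ?_⟩
      have hδv : δ ⟨v, hv⟩ = d := (hδ ⟨v, hv⟩).unique ht (hδε _) hde hV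
      apply Multiplicative.toAdd.injective
      funext i
      change (if q i ∣ δ ⟨v, hv⟩ then 1 else 0 : ZMod 2) = Multiplicative.toAdd s i
      have hinj : (∃ j, q j = q i ∧ Multiplicative.toAdd s j = 1) ↔
          Multiplicative.toAdd s i = 1 := by
        constructor
        · rintro ⟨j, hj, hs⟩
          rwa [t.primeFactors.equivFin.symm.injective (Subtype.ext hj)] at hs
        · exact fun h => ⟨i, rfl, h⟩
      rw [hδv, if_congr ((hd _ (hq i)).trans hinj) rfl rfl]
      generalize Multiplicative.toAdd s i = z
      revert z
      decide
    · ext g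
      rw [MonoidHom.mem_ker, Subgroup.mem_subgroupOf, hΓ, ← isInCoset_one_iff]
      constructor
      · intro h
        have h1 : δ g = 1 := by
          by_contra hne
          obtain ⟨p, hp, hpd⟩ := Nat.exists_prime_and_dvd hne
          obtain ⟨i, rfl⟩ := hq' p (Nat.mem_primeFactors.2
            ⟨hp, hpd.trans ⟨_, hδε g⟩, ht.ne'⟩)
          have h2 : (if q i ∣ δ g then 1 else 0 : ZMod 2) = 0 :=
            congrFun (congrArg Multiplicative.toAdd h) i
          simp [hpd] at h2
        have h2 := hδε g
        have h3 := hδ g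
        rw [h1, one_mul] at h2
        rwa [h1, ← h2] at h3
      · intro h
        have h1 : δ g = 1 := (hδ g).unique ht (hδε g) (one_mul t).symm h
        apply Multiplicative.toAdd.injective
        funext i
        change (if q i ∣ δ g then 1 else 0 : ZMod 2) = 0
        rw [h1, if_neg (Nat.prime_of_mem_primeFactors (hq i)).not_dvd_one]
  obtain ⟨f, hf, hker⟩ := key
  exact ⟨hker ▸ f.normal_ker, f, hf, hker⟩
end
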